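/- Let W(P) be the right-angled Coxeter group of a simple polytope P (generators s_F for facets F, with s_F² = 1 and (s_F s_{F'})² = 1 whenever F ∩ F' ≠ ∅). Then W(P) contains a subgroup isomorphic to ℤ × ℤ if and only if there exist four distinct facets F₁, F₂, F₃, F₄ of P with F₁ ∩ F₂ ≠ ∅, F₂ ∩ F₃ ≠ ∅, F₃ ∩ F₄ ≠ ∅, F₄ ∩ F₁ ≠ ∅, F₁ ∩ F₃ = ∅, and F₂ ∩ F₄ = ∅. -/

import Mathlib

/-- Relations of the right-angled Coxeter group on generating set `S` with
commutation relations given by `adj`. -/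
def racgRels {S : Type} (adj : S → S → Prop) : Set (FreeGroup S) :=
  {w | (∃ s : S, w = FreeGroup.of s ^ 2) ∨
    ∃ s t : S, adj s t ∧ w = (FreeGroup.of s * FreeGroup.of t) ^ 2}

/-- The right-angled Coxeter group associated to the adjacency relation `adj`. -/
def RACG {S : Type} (adj : S → S → Prop) : Type := PresentedGroup (racgRels adj)

instance {S : Type} (adj : S → S → Prop) : Group (RACG adj) :=
  inferInstanceAs (Group (PresentedGroup _))

/-- The generator of the right-angled Coxeter group corresponding to `s`. -/
def racgGen {S : Type} (adj : S → S → Prop) (s : S) : RACG adj := PresentedGroup.of s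

/-- The element of the right-angled Coxeter group represented by a word. -/
def wordProd {S : Type} (adj : S → S → Prop) (l : List S) : RACG adj :=
  (l.map (racgGen adj)).prod

/-- The word length of an element of a right-angled Coxeter group. -/
noncomputable def racgLength {S : Type} (adj : S → S → Prop) (x : RACG adj) : ℕ :=
  sInf {n | ∃ l : List S, l.length = n ∧ wordProd adj l = x}

namespace RACG

section Basic

variable {S : Type} {adj : S → S → Prop}

theorem gen_mul_self (s : S) : racgGen adj s * racgGen adj s = 1 := by
  have h : PresentedGroup.mk (racgRels adj) (FreeGroup.of s ^ 2) = 1 :=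
    PresentedGroup.one_of_mem (Or.inl ⟨s, rfl⟩)
  rw [map_pow, pow_two] at h
  exact h

theorem gen_inv (s : S) : (racgGen adj s)⁻¹ = racgGen adj s :=
  inv_eq_of_mul_eq_one_left (gen_mul_self s)

theorem gen_commute {s t : S} (hst : adj s t) : Commute (racgGen adj s) (racgGen adj t) := by
  have h : PresentedGroup.mk (racgRels adj) ((FreeGroup.of s * FreeGroup.of t) ^ 2) = 1 :=
    PresentedGroup.one_of_mem (Or.inr ⟨s, t, hst, rfl⟩)
  rw [map_pow, pow_two, map_mul] at h
  replace h := mul_eq_one_iff_eq_inv.mp h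
  rw [mul_inv_rev] at h
  change racgGen adj s * racgGen adj t = (racgGen adj t)⁻¹ * (racgGen adj s)⁻¹ at h
  rwa [gen_inv, gen_inv] at h

/-- The homomorphism out of a right-angled Coxeter group determined by the images of the
generators. -/
def lift {G : Type*} [Group G] (f : S → G) (hsq : ∀ s, f s * f s = 1)
    (hcomm : ∀ s t, adj s t → Commute (f s) (f t)) : RACG adj →* G :=
  PresentedGroup.toGroup (f := f) (rels := racgRels adj) (by
    rintro _ (⟨s, rfl⟩ | ⟨s, t, hst, rfl⟩)
    · simp [pow_two, hsq]
    · simp only [map_pow, map_mul, FreeGroup.lift_apply_of]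
      rw [(hcomm s t hst).mul_pow, pow_two, pow_two, hsq, hsq, one_mul])

@[simp]
theorem lift_gen {G : Type*} [Group G] (f : S → G) (hsq : ∀ s, f s * f s = 1)
    (hcomm : ∀ s t, adj s t → Commute (f s) (f t)) (s : S) :
    lift f hsq hcomm (racgGen adj s) = f s :=
  PresentedGroup.toGroup.of _

theorem hom_ext {G : Type*} [Group G] {f g : RACG adj →* G}
    (h : ∀ s, f (racgGen adj s) = g (racgGen adj s)) : f = g :=
  PresentedGroup.ext (rels := racgRels adj) h

@[elab_as_elim]
theorem induction_on {p : RACG adj → Prop} (w : RACG adj) (one : p 1)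
    (gen_mul : ∀ s w, p w → p (racgGen adj s * w)) : p w := by
  have hw : w ∈ Subgroup.closure (Set.range (racgGen adj)) := by
    have := PresentedGroup.closure_range_of (racgRels adj)
    exact (this.symm ▸ Subgroup.mem_top (G := PresentedGroup (racgRels adj)) w :)
  induction hw using Subgroup.closure_induction_left with
  | one => exact one
  | mul_left x hx y hy ih =>
    obtain ⟨s, rfl⟩ := hx
    exact gen_mul s y ih
  | inv_mul_cancel x hx y hy ih =>
    obtain ⟨s, rfl⟩ := hx
    rw [gen_inv]
    exact gen_mul s y ih

@[simp]
theorem wordProd_nil : wordProd adj [] = 1 := rfl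

@[simp]
theorem wordProd_cons (s : S) (l : List S) :
    wordProd adj (s :: l) = racgGen adj s * wordProd adj l := rfl

@[simp]
theorem wordProd_append (l m : List S) :
    wordProd adj (l ++ m) = wordProd adj l * wordProd adj m := by
  simp [wordProd]

@[simp]
theorem wordProd_reverse (l : List S) : wordProd adj l.reverse = (wordProd adj l)⁻¹ := by
  induction l with
  | nil => simp
  | cons s l ih => simp [ih, gen_inv]

theorem wordProd_surjective : Function.Surjective (wordProd adj) := fun w => by
  induction w using induction_on with
  | one => exact ⟨[], rfl⟩
  | gen_mul s w ih =>
    obtain ⟨l, rfl⟩ := ih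
    exact ⟨s :: l, rfl⟩

end Basic

end RACG

/-- The free product of copies of `ℤ/2` indexed by `X`. -/
abbrev FreeInvolutive (X : Type) : Type := RACG (fun _ _ : X => False)

namespace FreeInvolutive

open RACG

variable {X : Type}

/-- The element of the free product represented by a word. -/
abbrev word (l : List X) : FreeInvolutive X := wordProd (fun _ _ : X => False) l

/-- A word is reduced if no two consecutive letters agree. -/
abbrev Reduced (l : List X) : Prop := l.IsChain (· ≠ ·)

theorem Reduced.reverse {l : List X} (h : Reduced l) : Reduced l.reverse := by
  rw [Reduced, List.isChain_reverse]
  exact h.imp fun _ _ => Ne.symm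

theorem Reduced.map {Y : Type} {f : X → Y} (hf : Function.Injective f) {l : List X}
    (h : Reduced l) : Reduced (l.map f) := by
  rw [Reduced, List.isChain_map]
  exact h.imp fun _ _ => hf.ne

open Classical in
/-- Left multiplication of a reduced word by a letter. -/
noncomputable def push (x : X) : List X → List X
  | [] => [x]
  | y :: l => if x = y then l else x :: y :: l

theorem push_reduced (x : X) {l : List X} (h : Reduced l) : Reduced (push x l) := by
  cases l with
  | nil => exact List.isChain_singleton x
  | cons y l =>
    by_cases hxy : x = y
    · simpa [push, hxy] using h.tail
    · simpa [push, hxy] using h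

theorem push_push (x : X) {l : List X} (h : Reduced l) : push x (push x l) = l := by
  rcases l with _ | ⟨y, _ | ⟨z, l⟩⟩
  · simp [push]
  · by_cases hxy : x = y <;> simp [push, hxy]
  · by_cases hxy : x = y
    · have : y ≠ z := (List.isChain_cons_cons.mp h).1
      simp [push, hxy, this]
    · simp [push, hxy]

theorem push_of_reduced {x : X} {l : List X} (h : Reduced (x :: l)) : push x l = x :: l := by
  cases l with
  | nil => rfl
  | cons y l => simp [push, (List.isChain_cons_cons.mp h).1]

theorem word_push (x : X) (l : List X) : word (push x l) = word (x :: l) := by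
  cases l with
  | nil => rfl
  | cons y l =>
    by_cases hxy : x = y
    · subst hxy
      simp [push, word, ← mul_assoc, gen_mul_self]
    · simp [push, hxy]

theorem length_push_le (x : X) (l : List X) : (push x l).length ≤ l.length + 1 := by
  cases l with
  | nil => simp [push]
  | cons y l => by_cases hxy : x = y <;> simp [push, hxy]; omega

/-- The action of the free product on reduced words. -/
noncomputable def wordAction : FreeInvolutive X →* Equiv.Perm {l : List X // Reduced l} :=
  lift
    (fun x => Function.Involutive.toPerm (fun l => ⟨push x l.1, push_reduced x l.2⟩)
      fun l => Subtype.ext (push_push x l.2))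
    (fun x => Equiv.ext fun l => Subtype.ext (push_push x l.2))
    (fun _ _ h => h.elim)

theorem wordAction_word {l : List X} (h : Reduced l) :
    wordAction (word l) ⟨[], List.isChain_nil⟩ = ⟨l, h⟩ := by
  induction l with
  | nil => simp
  | cons x l ih =>
    rw [word, wordProd_cons, map_mul, Equiv.Perm.mul_apply, ih h.tail]
    simp only [wordAction, lift_gen]
    exact Subtype.ext (push_of_reduced h)

theorem word_injective {l m : List X} (hl : Reduced l) (hm : Reduced m)
    (h : word l = word m) : l = m := by
  have := wordAction_word hl
  rw [h, wordAction_word hm] at this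
  exact (congrArg Subtype.val this).symm

theorem exists_reduced_of_word (l : List X) :
    ∃ m, Reduced m ∧ word m = word l ∧ m.length ≤ l.length := by
  induction l with
  | nil => exact ⟨[], List.isChain_nil, rfl, le_rfl⟩
  | cons x l ih =>
    obtain ⟨m, hm, hml, hlen⟩ := ih
    refine ⟨push x m, push_reduced x hm, ?_, ?_⟩
    · rw [word_push, word, word, wordProd_cons, wordProd_cons]
      exact congrArg _ hml
    · have := length_push_le x m
      simp only [List.length_cons]
      omega

theorem exists_reduced (f : FreeInvolutive X) : ∃ l, Reduced l ∧ word l = f := by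
  obtain ⟨l, rfl⟩ := wordProd_surjective f
  obtain ⟨m, hm, hml, -⟩ := exists_reduced_of_word l
  exact ⟨m, hm, hml⟩

theorem reduced_of_word_eq {l m : List X} (hm : Reduced m) (h : word l = word m)
    (hlen : l.length = m.length) : Reduced l := by
  rw [Reduced, List.isChain_iff_forall_rel_of_append_cons_cons]
  rintro x y a b rfl rfl
  obtain ⟨k, hk, hkw, hklen⟩ := exists_reduced_of_word (a ++ b)
  have : k = m := by
    refine word_injective hk hm (hkw.trans (Eq.trans ?_ h))
    simp only [word, wordProd_append, wordProd_cons]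
    rw [← mul_assoc (racgGen _ x), gen_mul_self, one_mul]
  subst this
  simp at hlen hklen
  omega

/-- A word all of whose cyclic rotations are reduced. -/
abbrev CyclicallyReduced (l : List X) : Prop := Reduced (l ++ l)

theorem exists_conj_word (f : FreeInvolutive X) : ∃ (u : FreeInvolutive X) (l : List X),
    (CyclicallyReduced l ∨ ∃ x, l = [x]) ∧ f = u * word l * u⁻¹ := by
  obtain ⟨l, hl, rfl⟩ := exists_reduced f
  induction hn : l.length using Nat.strong_induction_on generalizing l with
  | _ n ih =>
    subst hn
    by_cases hc : CyclicallyReduced l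
    · exact ⟨1, l, Or.inl hc, by simp⟩
    simp only [CyclicallyReduced, Reduced, List.isChain_append, not_and, not_forall,
      not_not] at hc
    obtain ⟨x, hx, y, hy, rfl⟩ := hc hl hl
    rcases l with _ | ⟨y, l⟩
    · simp at hx
    obtain rfl : y = x := by simpa using hy
    rcases List.eq_nil_or_concat l with rfl | ⟨m, z, rfl⟩
    · exact ⟨1, [y], Or.inr ⟨y, rfl⟩, by simp⟩
    obtain rfl : z = y := by simpa [List.getLast?_cons] using hx
    have hm : Reduced m := by
      rw [List.concat_eq_append] at hl
      exact (List.isChain_append.mp hl.tail).1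
    obtain ⟨u, k, hk, hku⟩ := ih m.length (by simp) m hm rfl
    refine ⟨racgGen _ z * u, k, hk, ?_⟩
    simp only [word, wordProd_cons, wordProd_append, List.concat_eq_append, wordProd_nil,
      mul_one, mul_inv_rev, gen_inv] at hku ⊢
    rw [hku]
    group

theorem exists_conj_cyclicallyReduced {f : FreeInvolutive X} (hf : f * f ≠ 1) :
    ∃ (u : FreeInvolutive X) (l : List X), CyclicallyReduced l ∧ f = u * word l * u⁻¹ := by
  obtain ⟨u, l, hl | ⟨x, rfl⟩, h⟩ := exists_conj_word f
  · exact ⟨u, l, hl, h⟩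
  · refine (hf ?_).elim
    have hx : word [x] * word [x] = 1 := by simp [word, gen_mul_self]
    calc f * f = u * (word [x] * word [x]) * u⁻¹ := by rw [h]; group
      _ = 1 := by rw [hx]; group

theorem eq_flatten_append_of_append_comm {α : Type*} {l m k : List α} (hl : l ≠ [])
    (h : l ++ m = m ++ k) : ∃ (j : ℕ) (p : List α), p <+: l ∧
      m = (List.replicate j l).flatten ++ p := by
  induction hn : m.length using Nat.strong_induction_on generalizing m with
  | _ n ih =>
    subst hn
    rcases List.append_eq_append_iff.mp h with ⟨a, rfl, ha⟩ | ⟨b, rfl, -⟩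
    · obtain ⟨j, p, hp, hj⟩ := ih a.length
        (by have := List.length_pos_iff.mpr hl; simp; omega) ha rfl
      exact ⟨j + 1, p, hp, by simp [List.replicate_succ, hj]⟩
    · exact ⟨0, m, List.prefix_append _ _, by simp⟩

theorem word_flatten_replicate (j : ℕ) (l : List X) :
    word (List.replicate j l).flatten = word l ^ j := by
  induction j with
  | zero => simp [word]
  | succ j ih =>
    simp only [List.replicate_succ, List.flatten_cons, word, wordProd_append] at ih ⊢
    rw [ih, pow_succ']

theorem eq_pow_mul_prefix_of_reduced {l m k : List X} (hl : l ≠ []) (hlen : l.length = k.length)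
    (hmk : Reduced (m ++ k)) (h : word l * word m = word m * word k) :
    ∃ (j : ℕ) (p : List X), p <+: l ∧ word m = word l ^ j * word p := by
  simp only [word, ← wordProd_append] at h
  have hlm : Reduced (l ++ m) := reduced_of_word_eq hmk h (by simp; omega)
  obtain ⟨j, p, hp, hj⟩ := eq_flatten_append_of_append_comm hl (word_injective hlm hmk h)
  refine ⟨j, p, hp, ?_⟩
  rw [hj, ← word_flatten_replicate]
  simp [word]

theorem CyclicallyReduced.reverse {l : List X} (h : CyclicallyReduced l) :
    CyclicallyReduced l.reverse := by
  rw [CyclicallyReduced, ← List.reverse_append]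
  exact Reduced.reverse h

theorem CyclicallyReduced.map {Y : Type} {f : X → Y} (hf : Function.Injective f) {l : List X}
    (h : CyclicallyReduced l) : CyclicallyReduced (l.map f) := by
  rw [CyclicallyReduced, ← List.map_append]
  exact Reduced.map hf h

theorem eq_zpow_mul_prefix {l k : List X} (hl : l ≠ []) (hlen : l.length = k.length)
    (hk : CyclicallyReduced k) {φ : FreeInvolutive X} (h : word l * φ = φ * word k) :
    ∃ (j : ℤ) (p : List X), (p <+: l ∨ p <+: l.reverse) ∧ φ = word l ^ j * word p := by
  obtain ⟨m, hm, rfl⟩ := exists_reduced φ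
  have hk' := List.isChain_append.mp hk
  by_cases hmk : Reduced (m ++ k)
  · obtain ⟨j, p, hp, hj⟩ := eq_pow_mul_prefix_of_reduced hl hlen hmk h
    exact ⟨j, p, Or.inl hp, by simpa using hj⟩
  · have hmk' : Reduced (m ++ k.reverse) := by
      refine List.isChain_append.mpr ⟨hm, Reduced.reverse hk'.1, ?_⟩
      rintro x hx y hy rfl
      refine hmk (List.isChain_append.mpr ⟨hm, hk'.1, ?_⟩)
      rintro a ha b hb rfl
      rw [Option.mem_def] at hx hy ha hb
      rw [List.head?_reverse] at hy
      obtain rfl : x = a := by simpa [hx] using ha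
      exact hk'.2.2 x hy x hb rfl
    have h' : word l.reverse * word m = word m * word k.reverse := by
      simp only [word, wordProd_reverse]
      rw [inv_mul_eq_iff_eq_mul, ← mul_assoc, eq_mul_inv_iff_mul_eq]
      exact h.symm
    obtain ⟨j, p, hp, hj⟩ := eq_pow_mul_prefix_of_reduced (l := l.reverse) (by simpa using hl)
      (by simpa using hlen) hmk' h'
    refine ⟨-j, p, Or.inr hp, ?_⟩
    rw [hj]
    simp [word]

/-- The homomorphism of free products induced by a map of index sets. -/
def map {Y : Type} (e : X → Y) : FreeInvolutive X →* FreeInvolutive Y :=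
  lift (fun x => racgGen _ (e x)) (fun x => gen_mul_self (e x)) fun _ _ h => h.elim

/-- The action of permutations of the index set on the free product. -/
def permHom : Equiv.Perm X →* MulAut (FreeInvolutive X) where
  toFun e := MonoidHom.toMulEquiv (map e) (map e.symm)
    (hom_ext fun x => by simp [map]) (hom_ext fun x => by simp [map])
  map_one' := MulEquiv.toMonoidHom_injective (hom_ext fun x => by simp [map])
  map_mul' e e' := MulEquiv.toMonoidHom_injective (hom_ext fun x => by simp [map])

theorem permHom_gen (e : Equiv.Perm X) (x : X) :
    permHom e (racgGen _ x) = racgGen _ (e x) := by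
  simp [permHom, map]

theorem permHom_word (e : Equiv.Perm X) (l : List X) :
    permHom e (word l) = word (l.map e) := by
  induction l with
  | nil => simp [word]
  | cons x l ih =>
    simp only [word, wordProd_cons, map_mul, List.map_cons, permHom_gen] at ih ⊢
    rw [ih]

end FreeInvolutive

namespace FreeInvolutive

open RACG SemidirectProduct

variable {X : Type} {W : Type*} [Group W] (θ : W →* Equiv.Perm X)

theorem commute_inl_iff (g : FreeInvolutive X ⋊[permHom.comp θ] W) (f : FreeInvolutive X) :
    Commute g (inl f) ↔ f * g.left = g.left * permHom (θ g.right) f := by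
  simp only [Commute, SemiconjBy, SemidirectProduct.ext_iff, mul_left, mul_right, left_inl,
    right_inl, map_one, MulAut.one_apply, mul_one, one_mul, and_true, MonoidHom.comp_apply]
  exact eq_comm

theorem CyclicallyReduced.exists_ne {l : List X} (h : CyclicallyReduced l) (hl : l ≠ []) :
    ∃ x ∈ l, ∃ y ∈ l, x ≠ y := by
  rcases l with _ | ⟨x, _ | ⟨y, l⟩⟩
  · exact (hl rfl).elim
  · simp [CyclicallyReduced, Reduced] at h
  · exact ⟨x, by simp, y, by simp, (List.isChain_cons_cons.mp h).1⟩

/-- An element of `FreeInvolutive X ⋊ W` commuting with a cyclically reduced word has, up to that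
word, a power lying in `W`. -/
theorem exists_pow_mul_zpow_eq_inr {l : List X} (hl : CyclicallyReduced l) (hne : l ≠ [])
    {k : FreeInvolutive X ⋊[permHom.comp θ] W} (hk : Commute k (inl (word l))) :
    ∃ (d : ℕ) (e : ℤ) (w : W), 0 < d ∧ k ^ d * inl (word l) ^ e = inr w := by
  have key : ∀ i : ℕ, ∃ (j : ℤ) (p : List X), (p <+: l ∨ p <+: l.reverse) ∧
      (k ^ i).left = word l ^ j * word p := fun i => by
    have := (commute_inl_iff θ _ _).mp (hk.pow_left i)
    rw [permHom_word] at this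
    exact eq_zpow_mul_prefix hne (by simp) (hl.map (Equiv.injective _)) this
  choose j p hp hj using key
  have hfin : {q : List X | q <+: l ∨ q <+: l.reverse}.Finite :=
    (List.finite_toSet (l.inits ++ l.reverse.inits)).subset fun q hq => by simpa using hq
  obtain ⟨a, b, hab, hpab⟩ := hfin.exists_lt_map_eq_of_forall_mem hp
  have hdecomp : ∀ i, inl (word l) ^ (-j i) * k ^ i = inl (word (p i)) * inr (k ^ i).right := by
    intro i
    conv_lhs => rw [← inl_left_mul_inr_right (k ^ i), hj, map_mul, map_zpow]
    group
  refine ⟨b - a, j a - j b, (k ^ a).right⁻¹ * (k ^ b).right, by omega, ?_⟩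
  calc k ^ (b - a) * inl (word l) ^ (j a - j b)
      = (inl (word l) ^ (-j a) * k ^ a)⁻¹ * (inl (word l) ^ (-j b) * k ^ b) := by
        rw [(hk.pow_left (b - a)).zpow_right _ |>.eq, mul_inv_rev, mul_assoc, zpow_neg, inv_inv,
          ← mul_assoc (_ ^ j a), ← zpow_add, ← sub_eq_add_neg, ← mul_assoc,
          ((hk.pow_left a).inv_left.zpow_right _).eq, mul_assoc, pow_sub _ hab.le,
          ((Commute.refl k).pow_pow b a).inv_right.eq]
    _ = inr ((k ^ a).right⁻¹ * (k ^ b).right) := by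
        rw [hdecomp, hdecomp, hpab, map_mul, map_inv]
        group

theorem exists_pow_mul_zpow_eq_conj_inr {f : FreeInvolutive X} (hf : f * f ≠ 1)
    {h : FreeInvolutive X ⋊[permHom.comp θ] W} (hh : Commute h (inl f)) :
    ∃ (d : ℕ) (e : ℤ) (u : FreeInvolutive X) (w : W), 0 < d ∧
      h ^ d * inl f ^ e = inl u * inr w * (inl u)⁻¹ ∧
      ∃ x y, x ≠ y ∧ θ w x = x ∧ θ w y = y := by
  obtain ⟨u, l, hl, rfl⟩ := exists_conj_cyclicallyReduced hf
  have hne : l ≠ [] := by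
    rintro rfl
    simp [word] at hf
  have hk : Commute ((inl u)⁻¹ * h * inl u) (inl (word l)) := by
    have := (Commute.conj_iff (inl u)⁻¹).mpr hh
    simpa [mul_assoc] using this
  obtain ⟨d, e, w, hd, hw⟩ := exists_pow_mul_zpow_eq_inr θ hl hne hk
  have hfix : ∀ x ∈ l, θ w x = x := by
    have hcomm : Commute (inr w : FreeInvolutive X ⋊[permHom.comp θ] W) (inl (word l)) := by
      rw [← hw]
      exact (hk.pow_left d).mul_left ((Commute.refl _).zpow_left e)
    have := (commute_inl_iff θ _ _).mp hcomm
    simp only [left_inr, right_inr, mul_one, one_mul, permHom_word] at this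
    have hred := (List.isChain_append.mp hl).1
    have hmap := word_injective hred (Reduced.map (θ w).injective hred) this
    exact List.map_inj_left.mp (hmap.symm.trans (List.map_id l).symm)
  obtain ⟨x, hx, y, hy, hxy⟩ := hl.exists_ne hne
  refine ⟨d, e, u, w, hd, ?_, x, y, hxy, hfix x hx, hfix y hy⟩
  have hconj : h = inl u * ((inl u)⁻¹ * h * inl u) * (inl u)⁻¹ := by group
  rw [← hw, hconj, map_mul, map_mul, map_inv, conj_pow, conj_zpow]
  group

end FreeInvolutive

namespace RACG

open SemidirectProduct FreeInvolutive

section Retract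

variable {S : Type} {adj : S → S → Prop}

open Classical in
/-- The endomorphism killing the generators outside `T`; its image is the standard parabolic
subgroup on `T`. -/
noncomputable def retract (T : Set S) : RACG adj →* RACG adj :=
  lift (fun s => if s ∈ T then racgGen adj s else 1)
    (fun s => by split_ifs <;> simp [gen_mul_self])
    (fun s t hst => by split_ifs <;> simp [gen_commute hst])

theorem retract_gen_of_mem {T : Set S} {s : S} (hs : s ∈ T) :
    retract T (racgGen adj s) = racgGen adj s := by
  simp [retract, hs]

theorem retract_gen_of_notMem {T : Set S} {s : S} (hs : s ∉ T) :
    retract T (racgGen adj s) = 1 := by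
  simp [retract, hs]

theorem retract_retract (T U : Set S) (w : RACG adj) :
    retract T (retract U w) = retract (T ∩ U) w := by
  refine DFunLike.congr_fun (f := (retract T).comp (retract U)) (hom_ext fun s => ?_) w
  by_cases hT : s ∈ T <;> by_cases hU : s ∈ U <;>
    simp [retract_gen_of_mem, retract_gen_of_notMem, hT, hU]

theorem retract_retract_of_subset {T U : Set S} (h : T ⊆ U) (w : RACG adj) :
    retract T (retract U w) = retract T w := by
  rw [retract_retract, Set.inter_eq_left.mpr h]

theorem retract_idem (T : Set S) (w : RACG adj) : retract T (retract T w) = retract T w :=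
  retract_retract_of_subset subset_rfl w

@[simp]
theorem retract_univ (w : RACG adj) : retract Set.univ w = w :=
  DFunLike.congr_fun (g := MonoidHom.id _) (hom_ext fun s => by simp [retract]) w

@[simp]
theorem retract_empty (w : RACG adj) : retract ∅ w = 1 :=
  DFunLike.congr_fun (g := 1) (hom_ext fun s => by simp [retract]) w

theorem exists_retract_compl_singleton_ne [Finite S] {T : Set S} {c : RACG adj}
    (hc : retract T c ≠ c) : ∃ a ∉ T, retract {a}ᶜ c ≠ c := by
  by_contra! h
  have key : ∀ U : Set S, U.Finite → U ⊆ Tᶜ → retract Uᶜ c = c := by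
    intro U hU
    induction U, hU using Set.Finite.induction_on with
    | empty => simp
    | @insert a U _ _ ih =>
      intro hUT
      rw [Set.insert_subset_iff] at hUT
      rw [Set.insert_eq, Set.compl_union, ← retract_retract, ih hUT.2, h a hUT.1]
  exact hc (by simpa using key Tᶜ (Set.toFinite _) subset_rfl)

theorem retract_commute_gen {T : Set S} {s : S}
    (h : ∀ t ∈ T, Commute (racgGen adj t) (racgGen adj s)) (w : RACG adj) :
    Commute (retract T w) (racgGen adj s) := by
  induction w using induction_on with
  | one => simp
  | gen_mul t w ih =>
    rw [map_mul]
    refine Commute.mul_left ?_ ih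
    by_cases ht : t ∈ T
    · rw [retract_gen_of_mem ht]
      exact h t ht
    · simp [retract_gen_of_notMem ht]

theorem retract_mul_self {T : Set S}
    (h : ∀ s ∈ T, ∀ t ∈ T, Commute (racgGen adj s) (racgGen adj t)) (w : RACG adj) :
    retract T w * retract T w = 1 := by
  induction w using induction_on with
  | one => simp
  | gen_mul t w ih =>
    rw [map_mul]
    by_cases ht : t ∈ T
    · rw [retract_gen_of_mem ht]
      have hc := retract_commute_gen (fun s hs => h s hs t ht) w
      rw [mul_assoc, ← mul_assoc (retract T w), hc.eq, mul_assoc, ih, mul_one, gen_mul_self]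
    · simpa [retract_gen_of_notMem ht] using ih

end Retract

end RACG

namespace RACG

open SemidirectProduct FreeInvolutive

section Splitting

variable {V : Type} {Γ : SimpleGraph V} (v : V)

/-- The elements whose image under the retraction away from `v` lies in the standard parabolic
subgroup on the neighbours of `v`. -/
noncomputable def linkSubgroup (Γ : SimpleGraph V) (v : V) : Subgroup (RACG Γ.Adj) :=
  (retract (Γ.neighborSet v)).eqLocus (retract {v}ᶜ)

theorem mem_linkSubgroup {w : RACG Γ.Adj} :
    w ∈ linkSubgroup Γ v ↔ retract (Γ.neighborSet v) w = retract {v}ᶜ w :=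
  Iff.rfl

theorem neighborSet_subset_compl : Γ.neighborSet v ⊆ {v}ᶜ :=
  fun _ ht => Set.mem_compl_singleton_iff.mpr (Γ.ne_of_adj ht).symm

theorem commute_gen_of_mem_linkSubgroup {w : RACG Γ.Adj} (hw : w ∈ linkSubgroup Γ v) :
    Commute (retract {v}ᶜ w) (racgGen Γ.Adj v) := by
  rw [← (mem_linkSubgroup v).mp hw]
  exact retract_commute_gen (fun t ht => gen_commute (Γ.adj_symm ht)) w

/-- The left translation action on the cosets of `linkSubgroup Γ v`. -/
noncomputable def cosetPerm (Γ : SimpleGraph V) (v : V) :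
    RACG Γ.Adj →* Equiv.Perm (RACG Γ.Adj ⧸ linkSubgroup Γ v) :=
  MulAction.toPermHom _ _

theorem cosetPerm_mk (w u : RACG Γ.Adj) :
    cosetPerm Γ v w (u : RACG Γ.Adj ⧸ linkSubgroup Γ v) = ((w * u : RACG Γ.Adj) : _ ⧸ _) :=
  rfl

theorem cosetPerm_mk_eq_iff (w u : RACG Γ.Adj) :
    cosetPerm Γ v w (u : RACG Γ.Adj ⧸ linkSubgroup Γ v) = u ↔
      u⁻¹ * w * u ∈ linkSubgroup Γ v := by
  rw [cosetPerm_mk, eq_comm, QuotientGroup.eq, mul_assoc]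

/-- The semidirect product of the free product of the conjugates of the generator `v` with the
Coxeter group itself. -/
abbrev Splitting (Γ : SimpleGraph V) (v : V) : Type :=
  FreeInvolutive (RACG Γ.Adj ⧸ linkSubgroup Γ v) ⋊[permHom.comp (cosetPerm Γ v)] RACG Γ.Adj

theorem commute_inr_gen_inl_gen {t : V} (ht : Γ.Adj v t) :
    Commute (inr (racgGen Γ.Adj t) : Splitting Γ v)
      (inl (racgGen _ (QuotientGroup.mk 1))) := by
  rw [commute_inl_iff, left_inr, right_inr, mul_one, one_mul, permHom_gen,
    (cosetPerm_mk_eq_iff v _ _).mpr]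
  simp only [inv_one, one_mul, mul_one]
  rw [mem_linkSubgroup, retract_gen_of_mem (T := Γ.neighborSet v) ht,
    retract_gen_of_mem (neighborSet_subset_compl v ht)]

open Classical in
/-- The homomorphism to the splitting at `v`. -/
noncomputable def split (Γ : SimpleGraph V) (v : V) : RACG Γ.Adj →* Splitting Γ v :=
  lift (fun s => if s = v then inl (racgGen _ (QuotientGroup.mk 1))
      else inr (racgGen Γ.Adj s))
    (fun s => by split_ifs <;> rw [← map_mul, gen_mul_self, map_one])
    (fun s t hst => by
      split_ifs with hs ht ht
      · exact Commute.refl _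
      · exact (commute_inr_gen_inl_gen v (hs ▸ hst)).symm
      · exact commute_inr_gen_inl_gen v (ht ▸ hst.symm)
      · exact (gen_commute hst).map inr)

theorem split_gen_self :
    split Γ v (racgGen _ v) = inl (racgGen _ (QuotientGroup.mk 1)) := by
  simp [split]

theorem split_gen_of_ne {s : V} (hs : s ≠ v) :
    split Γ v (racgGen _ s) = inr (racgGen _ s) := by
  simp [split, hs]

/-- The homomorphism sending the free generator of a coset to the corresponding conjugate of
`v`. -/
noncomputable def conjugateHom (Γ : SimpleGraph V) (v : V) :
    FreeInvolutive (RACG Γ.Adj ⧸ linkSubgroup Γ v) →* RACG Γ.Adj :=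
  lift (Quotient.lift (fun u => retract {v}ᶜ u * racgGen Γ.Adj v * (retract {v}ᶜ u)⁻¹) (by
      intro a b hab
      have hc := commute_gen_of_mem_linkSubgroup v (QuotientGroup.leftRel_apply.mp hab)
      rw [map_mul, map_inv] at hc
      have := hc.eq
      rw [mul_assoc, inv_mul_eq_iff_eq_mul] at this
      rw [eq_mul_inv_iff_mul_eq, this]
      group))
    (fun x => by
      induction x using QuotientGroup.induction_on with
      | H u =>
        change retract {v}ᶜ u * racgGen Γ.Adj v * (retract {v}ᶜ u)⁻¹ *
          (retract {v}ᶜ u * racgGen Γ.Adj v * (retract {v}ᶜ u)⁻¹) = 1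
        rw [conj_mul, gen_mul_self]
        group)
    (fun _ _ h => h.elim)

theorem conjugateHom_gen (u : RACG Γ.Adj) :
    conjugateHom Γ v (racgGen _ (u : RACG Γ.Adj ⧸ linkSubgroup Γ v)) =
      retract {v}ᶜ u * racgGen Γ.Adj v * (retract {v}ᶜ u)⁻¹ :=
  lift_gen _ _ _ _

/-- The left inverse of `split`. -/
noncomputable def unsplit (Γ : SimpleGraph V) (v : V) : Splitting Γ v →* RACG Γ.Adj :=
  SemidirectProduct.lift (conjugateHom Γ v) (retract {v}ᶜ) fun w => hom_ext fun x => by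
    induction x using QuotientGroup.induction_on with
    | H u =>
      simp only [MonoidHom.comp_apply, MulEquiv.coe_toMonoidHom, permHom_gen, cosetPerm_mk,
        conjugateHom_gen, map_mul, MulAut.conj_apply]
      group

theorem unsplit_split (w : RACG Γ.Adj) : unsplit Γ v (split Γ v w) = w := by
  refine DFunLike.congr_fun (f := (unsplit Γ v).comp (split Γ v)) (g := MonoidHom.id _)
    (hom_ext fun s => ?_) w
  by_cases hs : s = v
  · subst hs
    simp [split_gen_self, unsplit, conjugateHom_gen]
  · simp [split_gen_of_ne v hs, unsplit, retract_gen_of_mem (T := {v}ᶜ) (adj := Γ.Adj) hs]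

theorem split_injective : Function.Injective (split Γ v) :=
  Function.LeftInverse.injective (unsplit_split v)

theorem right_split (w : RACG Γ.Adj) : (split Γ v w).right = retract {v}ᶜ w := by
  refine DFunLike.congr_fun (f := rightHom.comp (split Γ v)) (hom_ext fun s => ?_) w
  by_cases hs : s = v
  · subst hs
    simp [split_gen_self, retract_gen_of_notMem]
  · simp [split_gen_of_ne v hs, retract_gen_of_mem (T := {v}ᶜ) (adj := Γ.Adj) hs]

theorem split_retract {T : Set V} (hv : v ∉ T) (w : RACG Γ.Adj) :
    split Γ v (retract T w) = inr (retract T w) := by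
  refine DFunLike.congr_fun (f := (split Γ v).comp (retract T)) (g := inr.comp (retract T))
    (hom_ext fun s => ?_) w
  by_cases hs : s ∈ T
  · simp [retract_gen_of_mem hs, split_gen_of_ne v (ne_of_mem_of_not_mem hs hv)]
  · simp [retract_gen_of_notMem hs]

theorem split_eq_inl {w : RACG Γ.Adj} (hw : retract {v}ᶜ w = 1) :
    split Γ v w = inl (split Γ v w).left := by
  conv_lhs => rw [← inl_left_mul_inr_right (split Γ v w), right_split, hw, map_one, mul_one]

end Splitting

section FlatPlane

variable {V : Type} {Γ : SimpleGraph V}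

/-- An intersection of distinct conjugates of the standard parabolic subgroup on `T` lies, up to
conjugacy, in a smaller standard parabolic subgroup. -/
theorem exists_conj_retract_inter [Finite V] {T : Set V} {c x y : RACG Γ.Adj}
    (hc : retract T c ≠ c) (hx : retract T x = x) (hy : retract T y = y) (h : x * c = c * y) :
    ∃ a ∉ T, retract {a}ᶜ c ≠ c ∧
      ∃ u, retract (T ∩ Γ.neighborSet a) (u * x * u⁻¹) = u * x * u⁻¹ := by
  obtain ⟨a, haT, hac⟩ := exists_retract_compl_singleton_ne hc
  refine ⟨a, haT, hac, ?_⟩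
  have hxs : split Γ a x = inr x := by rw [← hx, split_retract a haT]
  have hys : split Γ a y = inr y := by rw [← hy, split_retract a haT]
  have hfix : permHom (cosetPerm Γ a x) (split Γ a c).left = (split Γ a c).left := by
    have := congrArg (fun z => (split Γ a z).left) h
    simpa [hxs, hys] using this
  obtain ⟨l, hl, hlc⟩ := exists_reduced (split Γ a c).left
  have hne : l ≠ [] := by
    rintro rfl
    refine hac ?_
    have : split Γ a c = split Γ a (retract {a}ᶜ c) := by
      rw [split_retract a (by simp), ← right_split, ← inl_left_mul_inr_right (split Γ a c), ← hlc]
      simp [word]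
    exact (split_injective a this).symm
  rw [← hlc, permHom_word] at hfix
  have hmap := word_injective (Reduced.map (Equiv.injective _) hl) hl hfix
  obtain ⟨z, l, rfl⟩ := List.exists_cons_of_ne_nil hne
  have hz : cosetPerm Γ a x z = z := (List.cons.inj hmap).1
  induction z using QuotientGroup.induction_on with
  | H u =>
    have hu := congrArg (retract T)
      ((mem_linkSubgroup a).mp ((cosetPerm_mk_eq_iff a x u).mp hz))
    rw [retract_retract, retract_retract_of_subset (Set.subset_compl_singleton_iff.mpr haT)] at hu
    refine ⟨(retract T u)⁻¹, ?_⟩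
    have hux : (retract T u)⁻¹ * x * (retract T u)⁻¹⁻¹ = retract T (u⁻¹ * x * u) := by
      simp [hx]
    rw [hux, retract_retract_of_subset Set.inter_subset_left, hu]

/-- Four vertices forming a cycle without chords. -/
def HasInducedSquare (Γ : SimpleGraph V) : Prop :=
  ∃ v₁ v₂ v₃ v₄ : V, v₁ ≠ v₂ ∧ v₁ ≠ v₃ ∧ v₁ ≠ v₄ ∧ v₂ ≠ v₃ ∧ v₂ ≠ v₄ ∧ v₃ ≠ v₄ ∧
    Γ.Adj v₁ v₂ ∧ Γ.Adj v₂ v₃ ∧ Γ.Adj v₃ v₄ ∧ Γ.Adj v₄ v₁ ∧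
    ¬ Γ.Adj v₁ v₃ ∧ ¬ Γ.Adj v₂ v₄

theorem hasInducedSquare_of_not_commute {a v s t : V} (hav : a ≠ v) (hadj : ¬ Γ.Adj v a)
    (hs : s ∈ Γ.neighborSet v ∩ Γ.neighborSet a) (ht : t ∈ Γ.neighborSet v ∩ Γ.neighborSet a)
    (hst : ¬ Commute (racgGen Γ.Adj s) (racgGen Γ.Adj t)) : HasInducedSquare Γ :=
  ⟨v, s, a, t, hs.1.ne, hav.symm, ht.1.ne, hs.2.ne.symm,
    fun h => hst (h ▸ Commute.refl _), ht.2.ne, hs.1, hs.2.symm, ht.2, ht.1.symm, hadj,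
    fun h => hst (gen_commute h)⟩

theorem hasInducedSquare_of_fixed_cosets [Finite V] {v : V} {w : RACG Γ.Adj}
    (hw : retract {v}ᶜ w * retract {v}ᶜ w ≠ 1) {x y : RACG Γ.Adj ⧸ linkSubgroup Γ v}
    (hxy : x ≠ y) (hx : cosetPerm Γ v w x = x) (hy : cosetPerm Γ v w y = y) :
    HasInducedSquare Γ := by
  induction x using QuotientGroup.induction_on with | H x => ?_
  induction y using QuotientGroup.induction_on with | H y => ?_
  rw [cosetPerm_mk_eq_iff, mem_linkSubgroup] at hx hy
  rw [Ne, QuotientGroup.eq, mem_linkSubgroup] at hxy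
  have hsub := neighborSet_subset_compl (Γ := Γ) v
  obtain ⟨a, ha, hac, u, hu⟩ := exists_conj_retract_inter (T := Γ.neighborSet v)
    (c := retract {v}ᶜ (x⁻¹ * y)) (x := retract {v}ᶜ (x⁻¹ * w * x))
    (y := retract {v}ᶜ (y⁻¹ * w * y))
    (by rwa [retract_retract_of_subset hsub])
    (by rwa [retract_retract_of_subset hsub])
    (by rwa [retract_retract_of_subset hsub])
    (by rw [← map_mul, ← map_mul]; group)
  have hav : a ≠ v := by
    rintro rfl
    exact hac (retract_idem _ _)
  by_contra hΓ
  have hcomm : ∀ s ∈ Γ.neighborSet v ∩ Γ.neighborSet a,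
      ∀ t ∈ Γ.neighborSet v ∩ Γ.neighborSet a,
      Commute (racgGen Γ.Adj s) (racgGen Γ.Adj t) := fun s hs t ht =>
    of_not_not fun hst => hΓ (hasInducedSquare_of_not_commute hav ha hs ht hst)
  have hsq := retract_mul_self hcomm (u * retract {v}ᶜ (x⁻¹ * w * x) * u⁻¹)
  have hconj : u * retract {v}ᶜ (x⁻¹ * w * x) * u⁻¹ =
      u * (retract {v}ᶜ x)⁻¹ * retract {v}ᶜ w * (u * (retract {v}ᶜ x)⁻¹)⁻¹ := by
    simp only [map_mul, map_inv]
    group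
  rw [hu, hconj, conj_mul, conj_eq_one_iff] at hsq
  exact hw hsq

/-- Two elements generating a free abelian group of rank two, if they commute. -/
def Independent {G : Type*} [Group G] (g h : G) : Prop :=
  ∀ m n : ℤ, g ^ m * h ^ n = 1 → m = 0 ∧ n = 0

theorem hasInducedSquare_of_retract_eq_one [Finite V] {v : V} {f k : RACG Γ.Adj}
    (hf : retract {v}ᶜ f = 1) (hc : Commute k f) (hi : Independent k f) :
    HasInducedSquare Γ := by
  have hsf := split_eq_inl v hf
  have hff : (split Γ v f).left * (split Γ v f).left ≠ 1 := fun h => by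
    have : split Γ v (f * f) = 1 := by rw [map_mul, hsf, ← map_mul, h, map_one]
    have := (map_eq_one_iff _ (split_injective v)).mp this
    have := (hi 0 2 (by rw [zpow_zero, one_mul, zpow_two, this])).2
    omega
  have hcs : Commute (split Γ v k) (inl (split Γ v f).left) := by
    rw [← hsf]
    exact hc.map (split Γ v)
  obtain ⟨d, e, u, w, hd, hw, x, y, hxy, hx, hy⟩ :=
    exists_pow_mul_zpow_eq_conj_inr _ hff hcs
  rw [← hsf, ← map_pow, ← map_zpow, ← map_mul] at hw
  have hwr : retract {v}ᶜ (k ^ d * f ^ e) = w := by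
    rw [← right_split, hw]
    simp
  refine hasInducedSquare_of_fixed_cosets (v := v) (w := w) (fun hww => ?_) hxy hx hy
  rw [← hwr, retract_idem, hwr] at hww
  have h1 : split Γ v ((k ^ d * f ^ e) * (k ^ d * f ^ e)) = 1 := by
    rw [map_mul, hw, conj_mul, ← map_mul, hww]
    simp
  have h2 := (map_eq_one_iff _ (split_injective v)).mp h1
  have h3 : k ^ (2 * d : ℤ) * f ^ (2 * e) = 1 := by
    rw [← h2, two_mul, two_mul, zpow_add, zpow_add, zpow_natCast,
      mul_assoc, mul_assoc, ← mul_assoc (f ^ e), ((hc.pow_left d).zpow_right e).symm.eq, mul_assoc]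
  have := (hi _ _ h3).1
  omega

theorem hasInducedSquare_of_independent_of_retract [Finite V] (T : Set V) (hT : T.Finite) :
    ∀ g h : RACG Γ.Adj, retract T g = g → retract T h = h → Commute g h → Independent g h →
      HasInducedSquare Γ := by
  induction T, hT using Set.Finite.induction_on with
  | empty =>
    intro g h hg _ _ hi
    rw [retract_empty] at hg
    have := (hi 1 0 (by simp [← hg])).1
    omega
  | @insert v T hv _ ih =>
    intro g h hg hh hc hi
    by_cases hind : Independent (retract {v}ᶜ g) (retract {v}ᶜ h)
    · have hsub : {v}ᶜ ∩ insert v T ⊆ T := fun s hs => hs.2.resolve_left hs.1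
      have hret : ∀ w : RACG Γ.Adj, retract (insert v T) w = w →
          retract T (retract {v}ᶜ w) = retract {v}ᶜ w := fun w hw => by
        rw [← hw, retract_retract {v}ᶜ, retract_retract, Set.inter_eq_right.mpr hsub]
      exact ih _ _ (hret g hg) (hret h hh) (hc.map _) hind
    · simp only [Independent, not_forall] at hind
      obtain ⟨m, n, h1, hmn⟩ := hind
      rw [← map_zpow, ← map_zpow, ← map_mul] at h1
      by_cases hm : m = 0
      · have hn : n ≠ 0 := fun hn => hmn ⟨hm, hn⟩
        refine hasInducedSquare_of_retract_eq_one h1 (k := g)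
          (((Commute.refl g).zpow_right m).mul_right (hc.zpow_right n)) fun i j hij => ?_
        rw [hm, zpow_zero, one_mul, ← zpow_mul] at hij
        simpa [hn] using hi _ _ hij
      · refine hasInducedSquare_of_retract_eq_one h1 (k := h)
          ((hc.symm.zpow_right m).mul_right ((Commute.refl h).zpow_right n)) fun i j hij => ?_
        have : g ^ (m * j) * h ^ (n * j + i) = 1 := by
          rw [← hij, ((hc.zpow_left m).zpow_right n).mul_zpow, ← zpow_mul, ← zpow_mul,
            (hc.symm.zpow_zpow i (m * j)).left_comm, zpow_add,
            ((Commute.refl h).zpow_zpow (n * j) i).eq]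
        have := hi _ _ this
        have hj : j = 0 := by simpa [hm] using this.1
        subst hj
        simpa using this

theorem hasInducedSquare_of_independent [Finite V] {g h : RACG Γ.Adj} (hc : Commute g h)
    (hi : Independent g h) : HasInducedSquare Γ :=
  hasInducedSquare_of_independent_of_retract Set.univ Set.finite_univ g h (by simp) (by simp) hc hi

open Classical in
/-- The homomorphism to the infinite dihedral group retaining only the generators `x` and `y`. -/
noncomputable def toDihedral {x y : V} (hadj : ¬ Γ.Adj x y) : RACG Γ.Adj →* DihedralGroup 0 :=
  lift (fun s => if s = x then DihedralGroup.sr 0 else if s = y then DihedralGroup.sr 1 else 1)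
    (fun s => by split_ifs <;> simp)
    (fun s t hst => by
      split_ifs with h₁ h₂ h₃ h₄ h₅ h₆ <;> first
        | exact Commute.refl _
        | exact Commute.one_left _
        | exact Commute.one_right _
        | (subst_vars; exact (hadj hst).elim)
        | (subst_vars; exact (hadj hst.symm).elim))

theorem toDihedral_gen_mul_gen {x y : V} (hxy : x ≠ y) (hadj : ¬ Γ.Adj x y) :
    toDihedral hadj (racgGen _ x * racgGen _ y) = DihedralGroup.r 1 := by
  simp [toDihedral, hxy.symm]

theorem toDihedral_gen_of_ne {x y s : V} (hadj : ¬ Γ.Adj x y) (hx : s ≠ x) (hy : s ≠ y) :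
    toDihedral hadj (racgGen _ s) = 1 := by
  simp [toDihedral, hx, hy]

theorem exists_independent_of_hasInducedSquare (h : HasInducedSquare Γ) :
    ∃ g h : RACG Γ.Adj, Commute g h ∧ Independent g h := by
  obtain ⟨v₁, v₂, v₃, v₄, h₁₂, h₁₃, h₁₄, h₂₃, h₂₄, h₃₄, a₁₂, a₂₃, a₃₄, a₄₁, n₁₃, n₂₄⟩ := h
  refine ⟨racgGen _ v₁ * racgGen _ v₃, racgGen _ v₂ * racgGen _ v₄, ?_, fun m n hmn => ?_⟩
  · exact ((gen_commute a₁₂).mul_right (gen_commute a₄₁.symm)).mul_left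
      ((gen_commute a₂₃.symm).mul_right (gen_commute a₃₄))
  · have e₁ := congrArg (toDihedral n₁₃) hmn
    have e₂ := congrArg (toDihedral n₂₄) hmn
    rw [map_mul, map_zpow, map_zpow, toDihedral_gen_mul_gen h₁₃, map_mul,
      toDihedral_gen_of_ne n₁₃ h₁₂.symm h₂₃, toDihedral_gen_of_ne n₁₃ h₁₄.symm h₃₄.symm] at e₁
    rw [map_mul, map_zpow, map_zpow, toDihedral_gen_mul_gen h₂₄, map_mul,
      toDihedral_gen_of_ne n₂₄ h₁₂ h₁₄, toDihedral_gen_of_ne n₂₄ h₂₃.symm h₃₄] at e₂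
    simp only [mul_one, one_zpow, one_mul, map_one, DihedralGroup.r_one_zpow] at e₁ e₂
    exact ⟨DihedralGroup.r.inj e₁, DihedralGroup.r.inj e₂⟩

end FlatPlane

end RACG

theorem exists_subgroup_mulEquiv_int_prod_iff {G : Type*} [Group G] :
    (∃ H : Subgroup G, Nonempty (H ≃* Multiplicative (ℤ × ℤ))) ↔
      ∃ g h : G, Commute g h ∧ RACG.Independent g h := by
  constructor
  · rintro ⟨H, ⟨e⟩⟩
    let a : Multiplicative (ℤ × ℤ) := Multiplicative.ofAdd (1, 0)
    let b : Multiplicative (ℤ × ℤ) := Multiplicative.ofAdd (0, 1)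
    refine ⟨e.symm a, e.symm b, ?_, fun m n hmn => ?_⟩
    · exact ((Commute.all a b).map e.symm).map H.subtype
    · have h1 : e.symm (a ^ m * b ^ n) = 1 := by
        rw [map_mul, map_zpow, map_zpow]
        exact Subtype.ext (by simpa using hmn)
      rw [map_eq_one_iff _ e.symm.injective] at h1
      simpa [a, b, ← ofAdd_zsmul, ← ofAdd_add] using h1
  · rintro ⟨g, h, hc, hi⟩
    let f : Multiplicative (ℤ × ℤ) →* G :=
      { toFun := fun z => g ^ z.toAdd.1 * h ^ z.toAdd.2
        map_one' := by simp
        map_mul' := fun z z' => by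
          simp only [toAdd_mul, Prod.fst_add, Prod.snd_add, zpow_add]
          exact ((hc.symm.zpow_zpow z.toAdd.2 z'.toAdd.1).mul_mul_mul_comm _ _).symm }
    have hf : Function.Injective f := (injective_iff_map_eq_one f).mpr fun z hz => by
      have := hi _ _ hz
      exact Multiplicative.toAdd.injective (Prod.ext this.1 this.2)
    exact ⟨f.range, ⟨(MonoidHom.ofInjective hf).symm⟩⟩

/-- The right-angled Coxeter group of a finite simple graph `Γ` contains a subgroup
isomorphic to `ℤ × ℤ` if and only if `Γ` contains an induced 4-cycle: four distinct
vertices `v₁, v₂, v₃, v₄` forming a cycle with no chords `v₁v₃` or `v₂v₄`. -/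
theorem racg_Z2_iff_induced_square {V : Type} [Fintype V] (Γ : SimpleGraph V) :
    (∃ H : Subgroup (RACG Γ.Adj), Nonempty (H ≃* Multiplicative (ℤ × ℤ))) ↔
    ∃ v₁ v₂ v₃ v₄ : V, v₁ ≠ v₂ ∧ v₁ ≠ v₃ ∧ v₁ ≠ v₄ ∧ v₂ ≠ v₃ ∧ v₂ ≠ v₄ ∧ v₃ ≠ v₄ ∧
      Γ.Adj v₁ v₂ ∧ Γ.Adj v₂ v₃ ∧ Γ.Adj v₃ v₄ ∧ Γ.Adj v₄ v₁ ∧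
      ¬ Γ.Adj v₁ v₃ ∧ ¬ Γ.Adj v₂ v₄ := by
  rw [exists_subgroup_mulEquiv_int_prod_iff]
  exact ⟨fun ⟨_, _, hc, hi⟩ => RACG.hasInducedSquare_of_independent hc hi,
    RACG.exists_independent_of_hasInducedSquare⟩
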